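/- arXiv:2406.17454 — 10 statements merged into one kernel-verified Lean document; each statement's English description precedes it below -/
import Mathlib

section
/- Let 𝒰 (respectively ℒ) denote the ℂ-subalgebra of the matrix algebra M₂(ℂ) consisting of all upper (respectively lower) triangular 2×2 complex matrices. If B is a ℂ-subalgebra of M₂(ℂ) containing 𝒰, then B = 𝒰 or B = M₂(ℂ); likewise, if B contains ℒ, then B = ℒ or B = M₂(ℂ). (Lemma 4.2 of the paper.) -/
/-- The subalgebra `𝒰` of upper triangular matrices in `M₂(ℂ)`. -/
def upperTriangularAlg : Subalgebra ℂ (Matrix (Fin 2) (Fin 2) ℂ) where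
  carrier := {X | X 1 0 = 0}
  add_mem' := by
    intro a b ha hb
    simp only [Set.mem_setOf_eq] at *
    simp [Matrix.add_apply, ha, hb]
  mul_mem' := by
    intro a b ha hb
    simp only [Set.mem_setOf_eq] at *
    simp [Matrix.mul_apply, Fin.sum_univ_two, ha, hb]
  one_mem' := by simp [Set.mem_setOf_eq, Matrix.one_apply]
  zero_mem' := by simp
  algebraMap_mem' := by
    intro r
    simp [Set.mem_setOf_eq, Matrix.algebraMap_matrix_apply]

/-- The subalgebra `ℒ` of lower triangular matrices in `M₂(ℂ)`. -/
def lowerTriangularAlg : Subalgebra ℂ (Matrix (Fin 2) (Fin 2) ℂ) where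
  carrier := {X | X 0 1 = 0}
  add_mem' := by
    intro a b ha hb
    simp only [Set.mem_setOf_eq] at *
    simp [Matrix.add_apply, ha, hb]
  mul_mem' := by
    intro a b ha hb
    simp only [Set.mem_setOf_eq] at *
    simp [Matrix.mul_apply, Fin.sum_univ_two, ha, hb]
  one_mem' := by simp [Set.mem_setOf_eq, Matrix.one_apply]
  zero_mem' := by simp
  algebraMap_mem' := by
    intro r
    simp [Set.mem_setOf_eq, Matrix.algebraMap_matrix_apply]

/-- A subalgebra containing the kernel of a linear functional is contained in that kernel
or is everything. -/
theorem Subalgebra.le_ker_or_eq_top {K A : Type*} [Field K] [Ring A] [Algebra K A]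
    (B : Subalgebra K A) (f : A →ₗ[K] K) (hB : ∀ x, f x = 0 → x ∈ B) :
    (∀ x ∈ B, f x = 0) ∨ B = ⊤ := by
  by_contra! h
  obtain ⟨⟨x, hx, hfx⟩, hne⟩ := h
  refine hne (Algebra.eq_top_iff.mpr fun y => ?_)
  have hy : y - (f y / f x) • x ∈ B := hB _ (by simp [hfx])
  simpa using B.add_mem hy (B.smul_mem hx (f y / f x))

/-- Lemma 4.2 of the paper: the only subalgebras of `M₂(ℂ)` containing `𝒰` are `𝒰` and
`M₂(ℂ)`, and the only subalgebras of `M₂(ℂ)` containing `ℒ` are `ℒ` and `M₂(ℂ)`. -/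
theorem subalgebra_containing_triangular (B : Subalgebra ℂ (Matrix (Fin 2) (Fin 2) ℂ)) :
    (upperTriangularAlg ≤ B → B = upperTriangularAlg ∨ B = ⊤) ∧
    (lowerTriangularAlg ≤ B → B = lowerTriangularAlg ∨ B = ⊤) := by
  refine ⟨fun h => ?_, fun h => ?_⟩
  · exact (B.le_ker_or_eq_top (Matrix.entryLinearMap ℂ ℂ 1 0) fun _ hX => h hX).imp_left
      fun hB => le_antisymm hB h
  · exact (B.le_ker_or_eq_top (Matrix.entryLinearMap ℂ ℂ 0 1) fun _ hX => h hX).imp_left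
      fun hB => le_antisymm hB h
end

section
/- Let 𝒟 denote the ℂ-subalgebra of the matrix algebra M₂(ℂ) consisting of all diagonal 2×2 complex matrices, 𝒰 the subalgebra of upper triangular matrices, and ℒ the subalgebra of lower triangular matrices. If B is a ℂ-subalgebra of M₂(ℂ) containing 𝒟, then B is one of 𝒟, 𝒰, ℒ, or M₂(ℂ). (Lemma 4.3 of the paper.) -/
/-- The subalgebra `𝒟` of diagonal matrices in `M₂(ℂ)`. -/
def diagonalAlg : Subalgebra ℂ (Matrix (Fin 2) (Fin 2) ℂ) where
  carrier := {X | X 0 1 = 0 ∧ X 1 0 = 0}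
  add_mem' := by
    intro a b ha hb
    simp only [Set.mem_setOf_eq] at *
    simp [Matrix.add_apply, ha.1, ha.2, hb.1, hb.2]
  mul_mem' := by
    intro a b ha hb
    simp only [Set.mem_setOf_eq] at *
    simp [Matrix.mul_apply, Fin.sum_univ_two, ha.1, ha.2, hb.1, hb.2]
  one_mem' := by simp [Set.mem_setOf_eq, Matrix.one_apply]
  zero_mem' := by simp
  algebraMap_mem' := by
    intro r
    simp [Set.mem_setOf_eq, Matrix.algebraMap_matrix_apply]

theorem mem_diagonalAlg {X : Matrix (Fin 2) (Fin 2) ℂ} :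
    X ∈ diagonalAlg ↔ X 0 1 = 0 ∧ X 1 0 = 0 := Iff.rfl

theorem mem_upperTriangularAlg {X : Matrix (Fin 2) (Fin 2) ℂ} :
    X ∈ upperTriangularAlg ↔ X 1 0 = 0 := Iff.rfl

theorem mem_lowerTriangularAlg {X : Matrix (Fin 2) (Fin 2) ℂ} :
    X ∈ lowerTriangularAlg ↔ X 0 1 = 0 := Iff.rfl

theorem single_self_mem_diagonalAlg (i : Fin 2) (c : ℂ) :
    Matrix.single i i c ∈ diagonalAlg := by
  rw [mem_diagonalAlg]
  fin_cases i <;> simp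

/-- A subalgebra containing the diagonal matrices contains every matrix unit whose entry is
nonzero in some element of the subalgebra. -/
theorem single_mem_of_diagonalAlg_le {B : Subalgebra ℂ (Matrix (Fin 2) (Fin 2) ℂ)}
    (hB : diagonalAlg ≤ B) {i j : Fin 2} {X : Matrix (Fin 2) (Fin 2) ℂ} (hX : X ∈ B)
    (hij : X i j ≠ 0) (c : ℂ) : Matrix.single i j c ∈ B := by
  have h : Matrix.single i i (c / X i j) * X * Matrix.single j j 1 ∈ B :=
    B.mul_mem (B.mul_mem (hB (single_self_mem_diagonalAlg i _)) hX)
      (hB (single_self_mem_diagonalAlg j _))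
  rwa [Matrix.single_mul_mul_single, mul_one, div_mul_cancel₀ c hij] at h

/-- Membership in a subalgebra containing the diagonal matrices can be checked on the
off-diagonal matrix units. -/
theorem mem_of_single_mem_of_diagonalAlg_le {B : Subalgebra ℂ (Matrix (Fin 2) (Fin 2) ℂ)}
    (hB : diagonalAlg ≤ B) {X : Matrix (Fin 2) (Fin 2) ℂ}
    (h01 : Matrix.single 0 1 (X 0 1) ∈ B) (h10 : Matrix.single 1 0 (X 1 0) ∈ B) : X ∈ B := by
  rw [Matrix.matrix_eq_sum_single X]
  simp only [Fin.sum_univ_two]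
  exact B.add_mem (B.add_mem (hB (single_self_mem_diagonalAlg 0 _)) h01)
    (B.add_mem h10 (hB (single_self_mem_diagonalAlg 1 _)))

/-- Lemma 4.3 of the paper: the only subalgebras of `M₂(ℂ)` containing the diagonal algebra
`𝒟` are `𝒟`, `𝒰`, `ℒ` and `M₂(ℂ)`. -/
theorem subalgebra_containing_diagonal (B : Subalgebra ℂ (Matrix (Fin 2) (Fin 2) ℂ))
    (hB : diagonalAlg ≤ B) :
    B = diagonalAlg ∨ B = upperTriangularAlg ∨ B = lowerTriangularAlg ∨ B = ⊤ := by
  have zero_mem (i j : Fin 2) {c : ℂ} (hc : c = 0) : Matrix.single i j c ∈ B := by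
    simp [hc]
  by_cases h01 : ∀ X ∈ B, X 0 1 = 0 <;> by_cases h10 : ∀ X ∈ B, X 1 0 = 0
  · exact Or.inl (le_antisymm (fun X hX => ⟨h01 X hX, h10 X hX⟩) hB)
  · push Not at h10
    obtain ⟨Y, hY, hY10⟩ := h10
    refine Or.inr (Or.inr (Or.inl (le_antisymm h01 fun X hX => ?_)))
    exact mem_of_single_mem_of_diagonalAlg_le hB (zero_mem 0 1 (mem_lowerTriangularAlg.1 hX))
      (single_mem_of_diagonalAlg_le hB hY hY10 _)
  · push Not at h01
    obtain ⟨Y, hY, hY01⟩ := h01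
    refine Or.inr (Or.inl (le_antisymm h10 fun X hX => ?_))
    exact mem_of_single_mem_of_diagonalAlg_le hB (single_mem_of_diagonalAlg_le hB hY hY01 _)
      (zero_mem 1 0 (mem_upperTriangularAlg.1 hX))
  · push Not at h01 h10
    obtain ⟨Y, hY, hY01⟩ := h01
    obtain ⟨Z, hZ, hZ10⟩ := h10
    refine Or.inr (Or.inr (Or.inr (eq_top_iff.2 fun X _ => ?_)))
    exact mem_of_single_mem_of_diagonalAlg_le hB (single_mem_of_diagonalAlg_le hB hY hY01 _)
      (single_mem_of_diagonalAlg_le hB hZ hZ10 _)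
end

section
/- Let 𝒥 denote the ℂ-subalgebra of the matrix algebra M₂(ℂ) consisting of all upper triangular 2×2 complex matrices with equal diagonal entries, and let 𝒰 denote the subalgebra of all upper triangular matrices. If B is a ℂ-subalgebra of M₂(ℂ) containing 𝒥, then B is one of 𝒥, 𝒰, or M₂(ℂ). (Lemma 4.4 of the paper.) -/
/-- The subalgebra `𝒥` of upper triangular matrices with equal diagonal entries in `M₂(ℂ)`. -/
def jordanAlg : Subalgebra ℂ (Matrix (Fin 2) (Fin 2) ℂ) where
  carrier := {X | X 1 0 = 0 ∧ X 0 0 = X 1 1}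
  add_mem' := by
    intro a b ha hb
    simp only [Set.mem_setOf_eq] at *
    simp [Matrix.add_apply, ha.1, ha.2, hb.1, hb.2]
  mul_mem' := by
    intro a b ha hb
    simp only [Set.mem_setOf_eq] at *
    simp [Matrix.mul_apply, Fin.sum_univ_two, ha.1, ha.2, hb.1, hb.2]
  one_mem' := by simp [Set.mem_setOf_eq, Matrix.one_apply]
  zero_mem' := by simp
  algebraMap_mem' := by
    intro r
    simp [Set.mem_setOf_eq, Matrix.algebraMap_matrix_apply]

theorem mem_jordanAlg {X : Matrix (Fin 2) (Fin 2) ℂ} :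
    X ∈ jordanAlg ↔ X 1 0 = 0 ∧ X 0 0 = X 1 1 := Iff.rfl

theorem upperTriangularAlg_le_of_mem {B : Subalgebra ℂ (Matrix (Fin 2) (Fin 2) ℂ)}
    (hB : jordanAlg ≤ B) {X : Matrix (Fin 2) (Fin 2) ℂ} (hX : X ∈ B) (h : X 1 0 = 0)
    (hd : X 0 0 ≠ X 1 1) : upperTriangularAlg ≤ B := by
  intro Y hY
  rw [mem_upperTriangularAlg] at hY
  have hd' : X 0 0 - X 1 1 ≠ 0 := sub_ne_zero.mpr hd
  set c := (Y 0 0 - Y 1 1) / (X 0 0 - X 1 1)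
  have hJ : Y - c • X ∈ jordanAlg := by
    refine mem_jordanAlg.mpr ⟨by simp [h, hY], ?_⟩
    have : c * (X 0 0 - X 1 1) = Y 0 0 - Y 1 1 := div_mul_cancel₀ _ hd'
    simp only [Matrix.sub_apply, Matrix.smul_apply, smul_eq_mul]
    linear_combination -this
  simpa using B.add_mem (hB hJ) (B.smul_mem hX c)

theorem eq_top_of_mem {B : Subalgebra ℂ (Matrix (Fin 2) (Fin 2) ℂ)}
    (hB : jordanAlg ≤ B) {X : Matrix (Fin 2) (Fin 2) ℂ} (hX : X ∈ B) (h : X 1 0 ≠ 0) :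
    B = ⊤ := by
  have hN : !![0, 1; 0, 0] ∈ B := hB (by simp [mem_jordanAlg])
  have hU : upperTriangularAlg ≤ B :=
    upperTriangularAlg_le_of_mem hB (B.mul_mem hN hX)
      (by simp [Matrix.mul_apply]) (by simpa [Matrix.mul_apply] using h)
  refine eq_top_iff.mpr fun Y _ => ?_
  have hY : Y - (Y 1 0 / X 1 0) • X ∈ upperTriangularAlg := by
    simp [mem_upperTriangularAlg, h]
  simpa using B.add_mem (hU hY) (B.smul_mem hX (Y 1 0 / X 1 0))

/-- Lemma 4.4 of the paper: the only subalgebras of `M₂(ℂ)` containing `𝒥` are `𝒥`, `𝒰`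
and `M₂(ℂ)`. -/
theorem subalgebra_containing_jordan (B : Subalgebra ℂ (Matrix (Fin 2) (Fin 2) ℂ))
    (hB : jordanAlg ≤ B) :
    B = jordanAlg ∨ B = upperTriangularAlg ∨ B = ⊤ := by
  by_cases hlow : ∃ X ∈ B, X 1 0 ≠ 0
  · obtain ⟨X, hX, h⟩ := hlow
    exact .inr (.inr (eq_top_of_mem hB hX h))
  push Not at hlow
  by_cases hdiag : ∃ X ∈ B, X 0 0 ≠ X 1 1
  · obtain ⟨X, hX, hd⟩ := hdiag
    exact .inr (.inl (le_antisymm hlow (upperTriangularAlg_le_of_mem hB hX (hlow X hX) hd)))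
  push Not at hdiag
  exact .inl (le_antisymm (fun X hX => ⟨hlow X hX, hdiag X hX⟩) hB)
end

section
/- Let G be a group, let H₁ and H₂ be subgroups of G whose union generates G, and let T be an abelian subgroup of G contained in both H₁ and H₂. Let ρ : G → SL₂(ℂ) be a group homomorphism such that: (a) ρ is irreducible, i.e. the only subspaces of ℂ² invariant under ρ(g) for all g ∈ G are 0 and ℂ²; (b) the image ρ(H₁) is non-abelian and the image ρ(H₂) is non-abelian; (c) the image ρ(T) is not contained in {I, −I}. Then there exist x₁ ∈ H₁, x₂ ∈ H₂, and γ ∈ T such that tr(ρ(x₁ x₂ γ)) ≠ tr(ρ(x₁ γ x₂)). (This is the group-theoretic content of Lemma 4.5 of the paper, where G = π₁(M), H_i = π₁(M_i), and T = π₁(T) for a separating incompressible torus T in M, so that π₁(M) is the amalgamated product of the π₁(M_i) over π₁(T).) -/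
namespace Matrix

/-- The centralizer of a non-scalar `2 × 2` matrix is commutative. -/
theorem mul_comm_of_commute_nonscalar {K : Type*} [Field K] {t a b : Matrix (Fin 2) (Fin 2) K}
    (ht : ¬ (t 0 1 = 0 ∧ t 1 0 = 0 ∧ t 0 0 = t 1 1))
    (ha : a * t = t * a) (hb : b * t = t * b) : a * b = b * a := by
  simp only [← Matrix.ext_iff, Fin.forall_fin_two, mul_apply, Fin.sum_univ_two] at ha hb ⊢
  grind

/-- A matrix trace-orthogonal to `1`, `a`, `b`, `a * b`, `b * a`, where `a` and `b` do not
commute, is singular. -/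
theorem det_eq_zero_of_trace_mul_eq_zero {K : Type*} [Field K]
    {a b N : Matrix (Fin 2) (Fin 2) K} (hab : a * b ≠ b * a) (h1 : N.trace = 0)
    (ha : (a * N).trace = 0) (hb : (b * N).trace = 0)
    (hc : (a * b * N).trace = 0) (hd : (b * a * N).trace = 0) : N.det = 0 := by
  by_contra h
  apply hab
  simp only [← Matrix.ext_iff, Fin.forall_fin_two, mul_apply, Fin.sum_univ_two, det_fin_two,
    trace_fin_two] at *
  grind

/-- Traceless singular `2 × 2` matrices that are trace-orthogonal to each other are
proportional, so they have the same trace-orthogonal complement. -/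
theorem trace_mul_eq_zero_of_isotropic {K : Type*} [Field K]
    {M N X : Matrix (Fin 2) (Fin 2) K} (hM : M ≠ 0) (hMt : M.trace = 0) (hMd : M.det = 0)
    (hNt : N.trace = 0) (hNd : N.det = 0) (hMN : (M * N).trace = 0)
    (hX : (X * M).trace = 0) : (X * N).trace = 0 := by
  by_contra h
  apply hM
  simp only [← Matrix.ext_iff, Fin.forall_fin_two, mul_apply, Fin.sum_univ_two, det_fin_two,
    trace_fin_two, zero_apply] at *
  have e1 : M 1 1 = - M 0 0 := by linear_combination hMt
  have e2 : N 1 1 = - N 0 0 := by linear_combination hNt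
  rw [e1, e2] at *
  have c1 : N 0 0 * M 0 1 = N 0 1 * M 0 0 := by grind
  have c2 : N 0 0 * M 1 0 = N 1 0 * M 0 0 := by grind
  have c3 : N 0 1 * M 1 0 = N 1 0 * M 0 1 := by grind
  grind

/-- The kernel of a traceless `2 × 2` matrix `N` is invariant under every matrix
trace-orthogonal to `N`. -/
theorem mulVec_mulVec_eq_zero_of_trace_mul_eq_zero {K : Type*} [Field K]
    {N X : Matrix (Fin 2) (Fin 2) K} (hNt : N.trace = 0) (hX : (X * N).trace = 0)
    {u : Fin 2 → K} (hu : N *ᵥ u = 0) : N *ᵥ (X *ᵥ u) = 0 := by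
  simp only [funext_iff, Fin.forall_fin_two, mul_apply, Fin.sum_univ_two,
    trace_fin_two, mulVec, dotProduct, Pi.zero_apply] at *
  grind

/-- A scalar `2 × 2` matrix of determinant `1` is `1` or `-1`. -/
theorem eq_one_or_eq_neg_one_of_scalar_of_det_eq_one {K : Type*} [Field K]
    {t : Matrix (Fin 2) (Fin 2) K} (h01 : t 0 1 = 0) (h10 : t 1 0 = 0) (h00 : t 0 0 = t 1 1)
    (hdet : t.det = 1) : t = 1 ∨ t = -1 := by
  rw [det_fin_two, h01, h00, zero_mul, sub_zero, mul_self_eq_one_iff] at hdet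
  rcases hdet with h | h
  · left; ext i j; fin_cases i <;> fin_cases j <;> simp [*]
  · right; ext i j; fin_cases i <;> fin_cases j <;> simp [*]

end Matrix

open scoped Matrix in
/-- Lemma 4.5 of the paper (group-theoretic content).  Let `G` be a group generated by two
subgroups `H₁`, `H₂`, and let `T` be an abelian subgroup contained in both.  If
`ρ : G → SL₂(ℂ)` is irreducible, restricts to non-abelian representations of `H₁` and `H₂`,
and restricts to a non-central representation of `T`, then there are `x₁ ∈ H₁`, `x₂ ∈ H₂`,
`γ ∈ T` with `tr ρ(x₁x₂γ) ≠ tr ρ(x₁γx₂)`. -/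
theorem exists_trace_ne_of_irreducible {G : Type*} [Group G] (H₁ H₂ T : Subgroup G)
    (hgen : Subgroup.closure ((H₁ : Set G) ∪ (H₂ : Set G)) = ⊤)
    (hT1 : T ≤ H₁) (hT2 : T ≤ H₂)
    (hTab : ∀ a ∈ T, ∀ b ∈ T, a * b = b * a)
    (ρ : G →* Matrix.SpecialLinearGroup (Fin 2) ℂ)
    (hirr : ∀ W : Submodule ℂ (Fin 2 → ℂ),
      (∀ g : G, ∀ v ∈ W, (ρ g : Matrix (Fin 2) (Fin 2) ℂ).mulVec v ∈ W) → W = ⊥ ∨ W = ⊤)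
    (hH₁ : ¬ ∀ a ∈ H₁, ∀ b ∈ H₁, ρ a * ρ b = ρ b * ρ a)
    (hH₂ : ¬ ∀ a ∈ H₂, ∀ b ∈ H₂, ρ a * ρ b = ρ b * ρ a)
    (hTnc : ∃ t ∈ T, (ρ t : Matrix (Fin 2) (Fin 2) ℂ) ≠ 1 ∧
      (ρ t : Matrix (Fin 2) (Fin 2) ℂ) ≠ -1) :
    ∃ x₁ ∈ H₁, ∃ x₂ ∈ H₂, ∃ γ ∈ T,
      Matrix.trace (ρ (x₁ * x₂ * γ) : Matrix (Fin 2) (Fin 2) ℂ) ≠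
        Matrix.trace (ρ (x₁ * γ * x₂) : Matrix (Fin 2) (Fin 2) ℂ) := by
  by_contra! hcon
  replace hcon : ∀ x₁ ∈ H₁, ∀ x₂ ∈ H₂, ∀ γ ∈ T,
      ((ρ x₁).1 * (ρ x₂).1 * (ρ γ).1).trace = ((ρ x₁).1 * (ρ γ).1 * (ρ x₂).1).trace := by
    intro x₁ h₁ x₂ h₂ γ hγ
    simpa using hcon x₁ h₁ x₂ h₂ γ hγ
  obtain ⟨t, htT, ht1, ht2⟩ := hTnc
  have hns : ¬ ((ρ t).1 0 1 = 0 ∧ (ρ t).1 1 0 = 0 ∧ (ρ t).1 0 0 = (ρ t).1 1 1) := by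
    rintro ⟨h01, h10, h00⟩
    rcases Matrix.eq_one_or_eq_neg_one_of_scalar_of_det_eq_one h01 h10 h00 (ρ t).2 with h | h
    · exact ht1 h
    · exact ht2 h
  have hcomm : ∀ H : Subgroup G, (¬ ∀ a ∈ H, ∀ b ∈ H, ρ a * ρ b = ρ b * ρ a) →
      ∃ x ∈ H, (ρ x).1 * (ρ t).1 - (ρ t).1 * (ρ x).1 ≠ 0 := by
    intro H hH
    by_contra! h
    refine hH fun a ha b hb => Subtype.ext ?_
    simpa using Matrix.mul_comm_of_commute_nonscalar hns
      (sub_eq_zero.mp (h a ha)) (sub_eq_zero.mp (h b hb))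
  have hval : ∀ x y : G, (ρ (x * y)).1 = (ρ x).1 * (ρ y).1 := fun x y => by simp
  have hdet : ∀ (H : Subgroup G) (N : Matrix (Fin 2) (Fin 2) ℂ),
      (¬ ∀ a ∈ H, ∀ b ∈ H, ρ a * ρ b = ρ b * ρ a) → N.trace = 0 →
      (∀ x ∈ H, ((ρ x).1 * N).trace = 0) → N.det = 0 := by
    intro H N hH hN hxN
    push Not at hH
    obtain ⟨a, ha, b, hb, hab⟩ := hH
    refine Matrix.det_eq_zero_of_trace_mul_eq_zero (a := (ρ a).1) (b := (ρ b).1) (fun h => hab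
      (Subtype.ext (by simpa using h))) hN (hxN a ha) (hxN b hb) ?_ ?_
    · rw [← hval]; exact hxN _ (H.mul_mem ha hb)
    · rw [← hval]; exact hxN _ (H.mul_mem hb ha)
  obtain ⟨x, hx, hM⟩ := hcomm H₁ hH₁
  obtain ⟨y, hy, hN⟩ := hcomm H₂ hH₂
  have hNorth : ∀ g ∈ H₁, ((ρ g).1 * ((ρ y).1 * (ρ t).1 - (ρ t).1 * (ρ y).1)).trace = 0 := by
    intro g hg
    rw [mul_sub, ← mul_assoc, ← mul_assoc, Matrix.trace_sub, hcon g hg y hy t htT, sub_self]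
  have hMorth : ∀ g ∈ H₂, ((ρ g).1 * ((ρ x).1 * (ρ t).1 - (ρ t).1 * (ρ x).1)).trace = 0 := by
    intro g hg
    rw [mul_sub, Matrix.trace_sub, Matrix.trace_mul_comm, ← hcon x hx g hg t htT,
      ← mul_assoc (ρ g).1, Matrix.trace_mul_comm _ (ρ x).1, ← mul_assoc, sub_self]
  have hMN : (((ρ x).1 * (ρ t).1 - (ρ t).1 * (ρ x).1) *
      ((ρ y).1 * (ρ t).1 - (ρ t).1 * (ρ y).1)).trace = 0 := by
    rw [sub_mul, Matrix.trace_sub, ← hval x t, ← hval t x,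
      hNorth _ (H₁.mul_mem hx (hT1 htT)), hNorth _ (H₁.mul_mem (hT1 htT) hx), sub_self]
  have hMt : ((ρ x).1 * (ρ t).1 - (ρ t).1 * (ρ x).1).trace = 0 := by
    rw [Matrix.trace_sub, Matrix.trace_mul_comm, sub_self]
  have hNt : ((ρ y).1 * (ρ t).1 - (ρ t).1 * (ρ y).1).trace = 0 := by
    rw [Matrix.trace_sub, Matrix.trace_mul_comm, sub_self]
  have hMd := hdet H₂ _ hH₂ hMt hMorth
  have hNd := hdet H₁ _ hH₁ hNt hNorth
  generalize (ρ x).1 * (ρ t).1 - (ρ t).1 * (ρ x).1 = M at *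
  generalize (ρ y).1 * (ρ t).1 - (ρ t).1 * (ρ y).1 = N at *
  have hinv : ∀ g : G, ∀ v : Fin 2 → ℂ, N *ᵥ v = 0 → N *ᵥ ((ρ g).1 *ᵥ v) = 0 := by
    intro g
    have hg : g ∈ Subgroup.closure ((H₁ : Set G) ∪ (H₂ : Set G)) := hgen ▸ Subgroup.mem_top g
    induction hg using Subgroup.closure_induction with
    | mem g hg =>
      intro v hv
      refine Matrix.mulVec_mulVec_eq_zero_of_trace_mul_eq_zero hNt ?_ hv
      rcases hg with hg | hg
      · exact hNorth g hg
      · exact Matrix.trace_mul_eq_zero_of_isotropic hM hMt hMd hNt hNd hMN (hMorth g hg)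
    | one => intro v hv; simpa using hv
    | mul a b _ _ ha hb =>
      intro v hv
      rw [hval, ← Matrix.mulVec_mulVec]
      exact ha _ (hb v hv)
    | inv a _ ha =>
      intro v hv
      have hadj : (ρ a⁻¹).1 = (ρ a).1.trace • 1 - (ρ a).1 := by
        rw [map_inv, Matrix.SpecialLinearGroup.coe_inv, Matrix.adjugate_fin_two]
        ext i j
        fin_cases i <;> fin_cases j <;> simp [Matrix.trace_fin_two]
      rw [hadj, Matrix.sub_mulVec, Matrix.mulVec_sub, ha v hv, Matrix.smul_mulVec,
        Matrix.one_mulVec, Matrix.mulVec_smul, hv, smul_zero, sub_zero]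
  rcases hirr (LinearMap.ker N.mulVecLin) fun g v hv => by simpa using hinv g v (by simpa using hv)
    with h | h
  · obtain ⟨v, hv0, hv⟩ := Matrix.exists_mulVec_eq_zero_iff.mpr hNd
    exact hv0 ((Submodule.mem_bot ℂ).mp (h ▸ (by simpa using hv : v ∈ LinearMap.ker N.mulVecLin)))
  · refine hN (Matrix.ext_of_mulVec_single fun i => ?_)
    have : Pi.single i 1 ∈ LinearMap.ker N.mulVecLin := h ▸ Submodule.mem_top
    simpa [funext_iff] using this
end

section
/- Let Δ be a subgroup of SL₂(ℂ) all of whose elements are diagonal matrices, with Δ not contained in {I, −I}, and let S be a subset of SL₂(ℂ) closed under right multiplication by Δ (i.e. X·D ∈ S whenever X ∈ S and D ∈ Δ). If tr(X D) = tr(X⁻¹ D) for every X ∈ S and every D ∈ Δ, then every X ∈ S is antidiagonal, i.e. both diagonal entries of X are 0. (This is the content of Case 1 of the proof of Theorem 3.7 of the paper, characterizing representations of dihedral type with respect to a non-separating torus.) -/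
/-- A diagonal element of `SL₂` over a domain with equal diagonal entries is `I` or `-I`. -/
theorem eq_one_or_eq_neg_one_of_diag_eq {R : Type*} [CommRing R] [IsDomain R]
    (D : Matrix.SpecialLinearGroup (Fin 2) R)
    (h01 : D.1 0 1 = 0) (h10 : D.1 1 0 = 0) (h : D.1 0 0 = D.1 1 1) :
    D.1 = 1 ∨ D.1 = -1 := by
  have hdet := D.2
  rw [Matrix.det_fin_two, h01, h, zero_mul, sub_zero, mul_self_eq_one_iff] at hdet
  refine hdet.imp (fun h1 => ?_) (fun h1 => ?_) <;>
  · ext i j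
    fin_cases i <;> fin_cases j <;> simp [h01, h10, h, h1]

/-- If `D` is a diagonal element of `SL₂` over a domain with distinct diagonal entries, then
`tr(XD) = tr(X⁻¹D)` forces the diagonal entries of `X` to agree. -/
theorem diag_eq_of_trace_mul_eq {R : Type*} [CommRing R] [IsDomain R]
    (X D : Matrix.SpecialLinearGroup (Fin 2) R)
    (h01 : D.1 0 1 = 0) (h10 : D.1 1 0 = 0) (hne : D.1 0 0 ≠ D.1 1 1)
    (htr : Matrix.trace (X * D).1 = Matrix.trace (X⁻¹ * D).1) :
    X.1 0 0 = X.1 1 1 := by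
  simp only [Matrix.SpecialLinearGroup.coe_mul, Matrix.SpecialLinearGroup.coe_inv,
    Matrix.adjugate_fin_two, Matrix.trace_fin_two, Matrix.mul_apply, Fin.sum_univ_two,
    Matrix.of_apply, Matrix.cons_val_zero, Matrix.cons_val_one, h01, h10] at htr
  refine mul_right_cancel₀ (sub_ne_zero.mpr hne) ?_
  linear_combination htr

/-- Case 1 of the proof of Theorem 3.7 of the paper.  Let `Δ` be a subgroup of `SL₂(ℂ)`
consisting of diagonal matrices and not contained in `{I, -I}`, and let `S` be a set of
elements of `SL₂(ℂ)` closed under right multiplication by `Δ`.  If `tr(XD) = tr(X⁻¹D)` for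
all `X ∈ S` and `D ∈ Δ`, then every `X ∈ S` is antidiagonal. -/
theorem antidiagonal_of_trace_eq (Δ : Subgroup (Matrix.SpecialLinearGroup (Fin 2) ℂ))
    (hdiag : ∀ D ∈ Δ, (D : Matrix (Fin 2) (Fin 2) ℂ) 0 1 = 0 ∧
      (D : Matrix (Fin 2) (Fin 2) ℂ) 1 0 = 0)
    (hnc : ∃ D ∈ Δ, (D : Matrix (Fin 2) (Fin 2) ℂ) ≠ 1 ∧
      (D : Matrix (Fin 2) (Fin 2) ℂ) ≠ -1)
    (S : Set (Matrix.SpecialLinearGroup (Fin 2) ℂ))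
    (hSmul : ∀ X ∈ S, ∀ D ∈ Δ, X * D ∈ S)
    (htr : ∀ X ∈ S, ∀ D ∈ Δ,
      Matrix.trace ((X * D : Matrix.SpecialLinearGroup (Fin 2) ℂ) : Matrix (Fin 2) (Fin 2) ℂ) =
      Matrix.trace ((X⁻¹ * D : Matrix.SpecialLinearGroup (Fin 2) ℂ) :
        Matrix (Fin 2) (Fin 2) ℂ)) :
    ∀ X ∈ S, (X : Matrix (Fin 2) (Fin 2) ℂ) 0 0 = 0 ∧
      (X : Matrix (Fin 2) (Fin 2) ℂ) 1 1 = 0 := by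
  obtain ⟨D, hD, hD1, hD2⟩ := hnc
  obtain ⟨h01, h10⟩ := hdiag D hD
  have hne : D.1 0 0 ≠ D.1 1 1 := fun h =>
    (eq_one_or_eq_neg_one_of_diag_eq D h01 h10 h).elim hD1 hD2
  intro X hX
  have hXd := diag_eq_of_trace_mul_eq X D h01 h10 hne (htr X hX D hD)
  have hXDd := diag_eq_of_trace_mul_eq (X * D) D h01 h10 hne (htr _ (hSmul X hX D hD) D hD)
  simp only [Matrix.SpecialLinearGroup.coe_mul, Matrix.mul_apply, Fin.sum_univ_two,
    h01, h10, mul_zero, add_zero, zero_add] at hXDd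
  have h0 : X.1 0 0 = 0 := by
    refine (mul_eq_zero.mp ?_).resolve_right (sub_ne_zero.mpr hne)
    linear_combination hXDd - D.1 1 1 * hXd
  exact ⟨h0, hXd ▸ h0⟩
end

section
/- Let Δ be a subgroup of SL₂(ℂ) all of whose elements are upper triangular with equal diagonal entries (i.e. of the form ±[[1, b], [0, 1]]), with Δ not contained in {I, −I}. If X ∈ SL₂(ℂ) satisfies tr(X D) = tr(X⁻¹ D) for every D ∈ Δ, then X is upper triangular, i.e. its lower-left entry is 0. (This is the content of Case 2 of the proof of Theorem 3.7 of the paper.) -/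
/-- Case 2 of the proof of Theorem 3.7 of the paper.  Let `Δ` be a subgroup of `SL₂(ℂ)` all of
whose elements are upper triangular with equal diagonal entries, with `Δ` not contained in
`{I, -I}`.  If `X ∈ SL₂(ℂ)` satisfies `tr(XD) = tr(X⁻¹D)` for all `D ∈ Δ`, then `X` is upper
triangular. -/
theorem upperTriangular_of_trace_eq (Δ : Subgroup (Matrix.SpecialLinearGroup (Fin 2) ℂ))
    (hform : ∀ D ∈ Δ, (D : Matrix (Fin 2) (Fin 2) ℂ) 1 0 = 0 ∧
      (D : Matrix (Fin 2) (Fin 2) ℂ) 0 0 = (D : Matrix (Fin 2) (Fin 2) ℂ) 1 1)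
    (hnc : ∃ D ∈ Δ, (D : Matrix (Fin 2) (Fin 2) ℂ) ≠ 1 ∧
      (D : Matrix (Fin 2) (Fin 2) ℂ) ≠ -1)
    (X : Matrix.SpecialLinearGroup (Fin 2) ℂ)
    (htr : ∀ D ∈ Δ,
      Matrix.trace ((X * D : Matrix.SpecialLinearGroup (Fin 2) ℂ) : Matrix (Fin 2) (Fin 2) ℂ) =
      Matrix.trace ((X⁻¹ * D : Matrix.SpecialLinearGroup (Fin 2) ℂ) :
        Matrix (Fin 2) (Fin 2) ℂ)) :
    (X : Matrix (Fin 2) (Fin 2) ℂ) 1 0 = 0 := by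
  obtain ⟨D, hD, hne_one, hne_neg_one⟩ := hnc
  obtain ⟨h10, hdiag⟩ := hform D hD
  have htrD := htr D hD
  have hdet := D.det_coe
  rw [Matrix.det_fin_two, h10, hdiag, mul_zero, sub_zero, mul_self_eq_one_iff] at hdet
  have h01 : (D : Matrix (Fin 2) (Fin 2) ℂ) 0 1 ≠ 0 := by
    intro h01
    rcases hdet with h11 | h11
    · refine hne_one ?_
      ext i j
      fin_cases i <;> fin_cases j <;> simp [h01, h10, hdiag, h11]
    · refine hne_neg_one ?_
      ext i j
      fin_cases i <;> fin_cases j <;> simp [h01, h10, hdiag, h11]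
  simp only [Matrix.SpecialLinearGroup.coe_mul, Matrix.SpecialLinearGroup.coe_inv,
    Matrix.adjugate_fin_two, Matrix.trace_fin_two, Matrix.mul_apply, Fin.sum_univ_two,
    Matrix.of_apply, Matrix.cons_val_zero, Matrix.cons_val_one, h10, hdiag] at htrD
  refine (mul_eq_zero.mp ?_).resolve_right h01
  linear_combination htrD / 2
end

section
/- Let Δ be a subgroup of SL₂(ℂ) all of whose elements are upper triangular with equal diagonal entries (i.e. of the form ±[[1, b], [0, 1]]), with Δ not contained in {I, −I}. Then the ℂ-subalgebra of the matrix algebra M₂(ℂ) generated by (the underlying matrices of) the elements of Δ contains every upper triangular 2×2 complex matrix with equal diagonal entries. (This supporting claim is established in Case 2 of the proof of Lemma 4.5 of the paper.) -/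
/-- From Case 2 of the proof of Lemma 4.5 of the paper: if `Δ` is a subgroup of `SL₂(ℂ)` all of
whose elements are upper triangular with equal diagonal entries, with `Δ` not contained in
`{I, -I}`, then the `ℂ`-subalgebra of `M₂(ℂ)` generated by the elements of `Δ` contains every
upper triangular matrix with equal diagonal entries. -/
theorem jordan_subset_adjoin (Δ : Subgroup (Matrix.SpecialLinearGroup (Fin 2) ℂ))
    (hform : ∀ D ∈ Δ, (D : Matrix (Fin 2) (Fin 2) ℂ) 1 0 = 0 ∧
      (D : Matrix (Fin 2) (Fin 2) ℂ) 0 0 = (D : Matrix (Fin 2) (Fin 2) ℂ) 1 1)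
    (hnc : ∃ D ∈ Δ, (D : Matrix (Fin 2) (Fin 2) ℂ) ≠ 1 ∧
      (D : Matrix (Fin 2) (Fin 2) ℂ) ≠ -1) :
    ∀ X : Matrix (Fin 2) (Fin 2) ℂ, X 1 0 = 0 → X 0 0 = X 1 1 →
      X ∈ Algebra.adjoin ℂ
        ((fun g : Matrix.SpecialLinearGroup (Fin 2) ℂ => (g : Matrix (Fin 2) (Fin 2) ℂ)) ''
          (Δ : Set (Matrix.SpecialLinearGroup (Fin 2) ℂ))) := by
  obtain ⟨D, hD, hD1, hD2⟩ := hnc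
  obtain ⟨h10, hdiag⟩ := hform D hD
  intro X hX10 hXdiag
  have hb : (D : Matrix (Fin 2) (Fin 2) ℂ) 0 1 ≠ 0 := by
    intro hb
    have hdet := D.det_coe
    rw [Matrix.det_fin_two, h10, hdiag, mul_zero, sub_zero] at hdet
    rcases mul_self_eq_one_iff.mp hdet with h | h
    · refine hD1 (Matrix.ext fun i j => ?_)
      fin_cases i <;> fin_cases j <;> simp [h10, hdiag, hb, h]
    · refine hD2 (Matrix.ext fun i j => ?_)
      fin_cases i <;> fin_cases j <;> simp [h10, hdiag, hb, h]
  set M := (D : Matrix (Fin 2) (Fin 2) ℂ)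
  have hX : X = (X 0 1 / M 0 1) • M +
      algebraMap ℂ (Matrix (Fin 2) (Fin 2) ℂ) (X 1 1 - X 0 1 / M 0 1 * M 1 1) := by
    ext i j
    fin_cases i <;> fin_cases j <;>
      simp [Matrix.algebraMap_matrix_apply, -map_sub, -map_mul, h10, hdiag, hX10, hXdiag, hb]
  rw [hX]
  refine add_mem (Subalgebra.smul_mem _ (Algebra.subset_adjoin (Set.mem_image_of_mem _ hD)) _)
    (Subalgebra.algebraMap_mem _ _)
end

section
/- For every triple of complex numbers (x, y, z) there exist matrices A, B ∈ SL₂(ℂ) such that tr(A) = x, tr(B) = y, and tr(A·B) = z. (This is the classical Fricke realization fact, used repeatedly in the paper: 'for a free group F₂ = ⟨a,b⟩ there is a representation achieving tr(a) = x, tr(b) = y, tr(ab) = z for any x, y, z ∈ ℂ'.) -/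
/-- The classical Fricke realization fact: for any complex numbers `x, y, z` there exist
`A, B ∈ SL₂(ℂ)` with `tr(A) = x`, `tr(B) = y` and `tr(AB) = z`. -/
theorem exists_SL2_with_traces (x y z : ℂ) :
    ∃ A B : Matrix.SpecialLinearGroup (Fin 2) ℂ,
      Matrix.trace (A : Matrix (Fin 2) (Fin 2) ℂ) = x ∧
      Matrix.trace (B : Matrix (Fin 2) (Fin 2) ℂ) = y ∧
      Matrix.trace ((A * B : Matrix.SpecialLinearGroup (Fin 2) ℂ) :
        Matrix (Fin 2) (Fin 2) ℂ) = z := by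
  obtain ⟨w, hw⟩ := IsAlgClosed.exists_pow_nat_eq (z ^ 2 - 4) two_pos
  obtain ⟨s, hs⟩ : ∃ s : ℂ, s * (z - s) = 1 :=
    ⟨(z + w) / 2, by linear_combination -hw / 4⟩
  obtain ⟨A, hA⟩ : ∃ A : Matrix.SpecialLinearGroup (Fin 2) ℂ,
      (A : Matrix (Fin 2) (Fin 2) ℂ) = !![x, -1; 1, 0] :=
    ⟨⟨_, by simp [Matrix.det_fin_two]⟩, rfl⟩
  obtain ⟨B, hB⟩ : ∃ B : Matrix.SpecialLinearGroup (Fin 2) ℂ,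
      (B : Matrix (Fin 2) (Fin 2) ℂ) = !![0, s; -(z - s), y] :=
    ⟨⟨_, by rw [Matrix.det_fin_two_of]; linear_combination hs⟩, rfl⟩
  refine ⟨A, B, ?_, ?_, ?_⟩
  · simp [hA, Matrix.trace_fin_two]
  · simp [hB, Matrix.trace_fin_two]
  · simp [hA, hB, Matrix.trace_fin_two]
end

section
/- For all natural numbers d₁, d₂ ≥ 3 and every complex number t, there exist matrices Q₁, Q₂ ∈ SL₂(ℂ) such that Q₁ has order exactly d₁, Q₂ has order exactly d₂, and tr(Q₁·Q₂) = t. (This realization statement is the key construction step in the proof of Lemma 6.2 of the paper, where representations of Seifert fibered pieces with two exceptional fibers are built with prescribed orders of the images of the exceptional-fiber generators and prescribed trace on the splitting torus.) -/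
theorem pow_matrix_of_mul_eq_zero {K : Type*} [Field K] {a x y : K} (ha : a ≠ 0)
    (hs : a - a⁻¹ ≠ 0) (hxy : x * y = 0) (n : ℕ) :
    (!![a, x; y, a⁻¹] : Matrix (Fin 2) (Fin 2) K) ^ n =
      !![a ^ n, x * ((a ^ n - (a⁻¹) ^ n) / (a - a⁻¹));
        y * ((a ^ n - (a⁻¹) ^ n) / (a - a⁻¹)), (a⁻¹) ^ n] := by
  induction n with
  | zero => simp [Matrix.one_fin_two]
  | succ n ih =>
    have hinv : a * a⁻¹ = 1 := mul_inv_cancel₀ ha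
    rw [pow_succ, ih, Matrix.mul_fin_two]
    generalize a⁻¹ = b at *
    ext i j
    fin_cases i <;> fin_cases j <;> simp
    · linear_combination ((a ^ n - b ^ n) / (a - b)) * hxy
    · field_simp
      ring
    · field_simp
      ring
    · linear_combination ((a ^ n - b ^ n) / (a - b)) * hxy

theorem orderOf_SL2_of_isPrimitiveRoot {K : Type*} [Field K] {d : ℕ} (hd : 3 ≤ d) {a x y : K}
    (ha : IsPrimitiveRoot a d) (hxy : x * y = 0) (A : Matrix.SpecialLinearGroup (Fin 2) K)
    (hA : (A : Matrix (Fin 2) (Fin 2) K) = !![a, x; y, a⁻¹]) : orderOf A = d := by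
  have ha0 : a ≠ 0 := ha.ne_zero (by omega)
  have hs : a - a⁻¹ ≠ 0 := by
    intro h
    refine ha.pow_ne_one_of_pos_of_lt (l := 2) (by norm_num) (by omega) ?_
    rw [sq]
    nth_rewrite 2 [sub_eq_zero.mp h]
    exact mul_inv_cancel₀ ha0
  have hpow (n : ℕ) : A ^ n = 1 ↔ a ^ n = 1 := by
    have hcoe : A ^ n = 1 ↔ (A : Matrix (Fin 2) (Fin 2) K) ^ n = 1 := by
      rw [← Matrix.SpecialLinearGroup.coe_pow, ← Matrix.SpecialLinearGroup.coe_one]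
      exact Subtype.val_injective.eq_iff.symm
    rw [hcoe, hA,
      pow_matrix_of_mul_eq_zero ha0 hs hxy]
    constructor
    · intro h
      simpa using congrFun (congrFun h 0) 0
    · intro h
      simp [h, Matrix.one_fin_two]
  rw [ha.eq_orderOf]
  exact orderOf_eq_orderOf_iff.mpr hpow

/-- The key construction step in the proof of Lemma 6.2 of the paper: for any `d₁, d₂ ≥ 3` and
any `t ∈ ℂ`, there exist `Q₁, Q₂ ∈ SL₂(ℂ)` with `Q₁` of order exactly `d₁`, `Q₂` of order
exactly `d₂`, and `tr(Q₁Q₂) = t`. -/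
theorem exists_SL2_with_orders_and_trace (d₁ d₂ : ℕ) (h₁ : 3 ≤ d₁) (h₂ : 3 ≤ d₂) (t : ℂ) :
    ∃ Q₁ Q₂ : Matrix.SpecialLinearGroup (Fin 2) ℂ,
      orderOf Q₁ = d₁ ∧ orderOf Q₂ = d₂ ∧
      Matrix.trace ((Q₁ * Q₂ : Matrix.SpecialLinearGroup (Fin 2) ℂ) :
        Matrix (Fin 2) (Fin 2) ℂ) = t := by
  have ha := Complex.isPrimitiveRoot_exp d₁ (by omega)
  have hb := Complex.isPrimitiveRoot_exp d₂ (by omega)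
  generalize Complex.exp (2 * Real.pi * Complex.I / d₁) = a at ha
  generalize Complex.exp (2 * Real.pi * Complex.I / d₂) = b at hb
  have ha0 : a ≠ 0 := ha.ne_zero (by omega)
  have hb0 : b ≠ 0 := hb.ne_zero (by omega)
  refine ⟨⟨!![a, 1; 0, a⁻¹], by simp [ha0]⟩,
    ⟨!![b, 0; t - a * b - a⁻¹ * b⁻¹, b⁻¹], by simp [hb0]⟩,
    orderOf_SL2_of_isPrimitiveRoot h₁ ha (mul_zero _) _ rfl,
    orderOf_SL2_of_isPrimitiveRoot h₂ hb (zero_mul _) _ rfl, ?_⟩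
  change Matrix.trace (!![a, 1; 0, a⁻¹] * !![b, 0; t - a * b - a⁻¹ * b⁻¹, b⁻¹]) = t
  rw [Matrix.mul_fin_two, Matrix.trace_fin_two_of]
  ring
end

section
/- Let α and β be coprime integers with α ≥ 2, and let x, y be complex numbers with y ≠ −2. Then there exist matrices a, q, c, h ∈ SL₂(ℂ) satisfying: h = −I; a·h·a⁻¹ = h⁻¹; h·c = c·h; h·q = q·h; q^α · h^β = I; q·c·a² = I; tr(c) = x; and tr(q·c) = y. (This is the representation-existence claim in the proof of Lemma 6.5 of the paper, producing, for the fundamental group presentation ⟨a, q, c, h | aha⁻¹ = h⁻¹, [h,c] = [h,q] = 1, q^α h^β = 1, qca² = 1⟩ of a Seifert manifold over the Möbius band with one exceptional fiber of parameters (β, α), representations with ρ(h) = −I and prescribed traces tr ρ(c) = x, tr ρ(qc) = y; the hypothesis y ≠ −2 is needed so that (qc)⁻¹ admits a square root in SL₂(ℂ).) -/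
open Matrix in
/-- The diagonal torus `u ↦ diag(u, u⁻¹)` of `SL₂`. -/
def diagTorus (K : Type*) [Field K] : Kˣ →* SpecialLinearGroup (Fin 2) K where
  toFun u := ⟨!![(u : K), 0; 0, (↑u⁻¹ : K)], by simp [det_fin_two]⟩
  map_one' := by
    ext i j
    fin_cases i <;> fin_cases j <;> simp
  map_mul' u v := by
    apply Subtype.ext
    change _ = !![(u : K), 0; 0, (↑u⁻¹ : K)] * !![(v : K), 0; 0, (↑v⁻¹ : K)]
    simp [mul_comm]

theorem coe_diagTorus {K : Type*} [Field K] (u : Kˣ) :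
    (diagTorus K u : Matrix (Fin 2) (Fin 2) K) = !![(u : K), 0; 0, (u : K)⁻¹] := by
  rw [← Units.val_inv_eq_inv_val]
  rfl

theorem coe_diagTorus_neg_one (K : Type*) [Field K] :
    (diagTorus K (-1) : Matrix (Fin 2) (Fin 2) K) = -1 := by
  ext i j
  fin_cases i <;> fin_cases j <;> simp [coe_diagTorus]

theorem commute_diagTorus_neg_one {K : Type*} [Field K]
    (g : Matrix.SpecialLinearGroup (Fin 2) K) : Commute (diagTorus K (-1)) g := by
  apply Subtype.ext
  simp only [Matrix.SpecialLinearGroup.coe_mul, coe_diagTorus_neg_one, neg_mul, one_mul,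
    mul_neg, mul_one]

/-- A matrix in `SL₂(ℂ)` whose trace is not `-2` has a square root in `SL₂(ℂ)`. -/
theorem exists_sq_eq_of_trace_ne_neg_two (g : Matrix.SpecialLinearGroup (Fin 2) ℂ)
    (hg : Matrix.trace (g : Matrix (Fin 2) (Fin 2) ℂ) ≠ -2) :
    ∃ a : Matrix.SpecialLinearGroup (Fin 2) ℂ, a ^ 2 = g := by
  obtain ⟨w, hw⟩ := IsAlgClosed.exists_pow_nat_eq
    (Matrix.trace (g : Matrix (Fin 2) (Fin 2) ℂ) + 2) two_pos
  have hw0 : w ≠ 0 := by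
    rintro rfl
    exact hg (by linear_combination -hw)
  have hdet := g.det_coe
  rw [Matrix.det_fin_two] at hdet
  rw [Matrix.trace_fin_two] at hw
  have hdet' : (w⁻¹ • ((g : Matrix (Fin 2) (Fin 2) ℂ) + 1)).det = 1 := by
    simp only [Matrix.det_fin_two, Matrix.smul_apply, Matrix.add_apply, smul_eq_mul,
      Matrix.one_apply_eq, ne_eq, zero_ne_one, one_ne_zero, not_false_eq_true,
      Matrix.one_apply_ne, add_zero]
    field_simp
    linear_combination hdet - hw
  obtain ⟨a, ha⟩ : ∃ a : Matrix.SpecialLinearGroup (Fin 2) ℂ,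
      (a : Matrix (Fin 2) (Fin 2) ℂ) = w⁻¹ • ((g : Matrix (Fin 2) (Fin 2) ℂ) + 1) :=
    ⟨⟨_, hdet'⟩, rfl⟩
  refine ⟨a, Subtype.ext ?_⟩
  rw [Matrix.SpecialLinearGroup.coe_pow, ha, sq]
  ext i j
  fin_cases i <;> fin_cases j <;>
    simp [Matrix.mul_apply, Fin.sum_univ_two] <;> field_simp
  · linear_combination -(g 0 0) * hw - hdet
  · linear_combination -(g 0 1) * hw
  · linear_combination -(g 1 0) * hw
  · linear_combination -(g 1 1) * hw - hdet

theorem exists_trace_eq_trace_diagTorus_mul_eq {K : Type*} [Field K] {u : Kˣ}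
    (hu : u ^ 2 ≠ 1) (x y : K) :
    ∃ c : Matrix.SpecialLinearGroup (Fin 2) K,
      Matrix.trace (c : Matrix (Fin 2) (Fin 2) K) = x ∧
      Matrix.trace ((diagTorus K u * c : Matrix.SpecialLinearGroup (Fin 2) K) :
        Matrix (Fin 2) (Fin 2) K) = y := by
  have hd : (u : K) ^ 2 - 1 ≠ 0 := by
    rw [sub_ne_zero]
    exact fun h ↦ hu (Units.ext (by simpa using h))
  have hu0 : (u : K) ≠ 0 := u.ne_zero
  obtain ⟨p, hp⟩ : ∃ p : K, p * ((u : K) ^ 2 - 1) = u * y - x :=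
    ⟨_, div_mul_cancel₀ _ hd⟩
  obtain ⟨c, hc⟩ : ∃ c : Matrix.SpecialLinearGroup (Fin 2) K,
      (c : Matrix (Fin 2) (Fin 2) K) = !![p, 1; p * (x - p) - 1, x - p] :=
    ⟨⟨_, by simp [Matrix.det_fin_two]⟩, rfl⟩
  refine ⟨c, ?_, ?_⟩
  · simp [hc, Matrix.trace_fin_two]
  · rw [Matrix.SpecialLinearGroup.coe_mul, coe_diagTorus, hc]
    simp [Matrix.trace_fin_two]
    field_simp
    linear_combination hp

theorem exists_zpow_eq_neg_one_zpow {α β : ℤ} (hcop : Int.gcd α β = 1) (hα : 2 ≤ α) :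
    ∃ u : ℂˣ, u ^ 2 ≠ 1 ∧ u ^ α = (-1) ^ β := by
  lift α to ℕ using by lia
  have hα' : 2 ≤ α := by exact_mod_cast hα
  rcases Int.even_or_odd β with hβ | hβ
  · have hne : α ≠ 2 := by
      rintro rfl
      have := Int.dvd_coe_gcd (dvd_refl ((2 : ℕ) : ℤ)) hβ.two_dvd
      rw [hcop] at this
      norm_num at this
    obtain ⟨u, hu⟩ := (Complex.isPrimitiveRoot_exp α (by lia)).isUnit (by lia)
    have hprim : IsPrimitiveRoot u α := by
      rw [← IsPrimitiveRoot.coe_units_iff, hu]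
      exact Complex.isPrimitiveRoot_exp α (by lia)
    refine ⟨u, hprim.pow_ne_one_of_pos_of_lt two_ne_zero (by lia), ?_⟩
    rw [hβ.neg_one_zpow, zpow_natCast, hprim.pow_eq_one]
  · obtain ⟨u, hu⟩ := (Complex.isPrimitiveRoot_exp (2 * α) (by lia)).isUnit (by lia)
    have hprim : IsPrimitiveRoot u (2 * α) := by
      rw [← IsPrimitiveRoot.coe_units_iff, hu]
      exact Complex.isPrimitiveRoot_exp (2 * α) (by lia)
    refine ⟨u, hprim.pow_ne_one_of_pos_of_lt two_ne_zero (by lia), ?_⟩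
    have h1 : u ^ α ≠ 1 := hprim.pow_ne_one_of_pos_of_lt (by lia) (by lia)
    have h2 : (u ^ α) ^ 2 = 1 := by rw [← pow_mul, mul_comm, hprim.pow_eq_one]
    rw [hβ.neg_one_zpow, zpow_natCast]
    have h3 : ((u ^ α : ℂˣ) : ℂ) ^ 2 = 1 := by simpa using congrArg Units.val h2
    rcases (mul_self_eq_one_iff.mp ((sq _).symm.trans h3)) with h | h
    · exact absurd (Units.ext h) h1
    · exact Units.ext h

/-- The representation-existence claim in the proof of Lemma 6.5 of the paper: for coprime
integers `α ≥ 2`, `β`, and complex numbers `x`, `y` with `y ≠ -2`, there exist matrices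
`a, q, c, h ∈ SL₂(ℂ)` satisfying the relations of the fundamental group presentation
`⟨a, q, c, h | aha⁻¹ = h⁻¹, [h,c] = [h,q] = 1, q^α h^β = 1, qca² = 1⟩` with `h = -I`,
`tr(c) = x` and `tr(qc) = y`. -/
theorem exists_SL2_rep_mobius_band (α β : ℤ) (hcop : Int.gcd α β = 1) (hα : 2 ≤ α)
    (x y : ℂ) (hy : y ≠ -2) :
    ∃ a q c h : Matrix.SpecialLinearGroup (Fin 2) ℂ,
      (h : Matrix (Fin 2) (Fin 2) ℂ) = -1 ∧
      a * h * a⁻¹ = h⁻¹ ∧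
      h * c = c * h ∧
      h * q = q * h ∧
      q ^ α * h ^ β = 1 ∧
      q * c * a ^ 2 = 1 ∧
      Matrix.trace (c : Matrix (Fin 2) (Fin 2) ℂ) = x ∧
      Matrix.trace ((q * c : Matrix.SpecialLinearGroup (Fin 2) ℂ) :
        Matrix (Fin 2) (Fin 2) ℂ) = y := by
  obtain ⟨u, hu, hpow⟩ := exists_zpow_eq_neg_one_zpow hcop hα
  obtain ⟨c, hc, hqc⟩ := exists_trace_eq_trace_diagTorus_mul_eq hu x y
  obtain ⟨b, hb⟩ := exists_sq_eq_of_trace_ne_neg_two (diagTorus ℂ u * c) (by rwa [hqc])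
  refine ⟨b⁻¹, diagTorus ℂ u, c, diagTorus ℂ (-1), coe_diagTorus_neg_one ℂ, ?_,
    commute_diagTorus_neg_one c, commute_diagTorus_neg_one _, ?_, ?_, hc, hqc⟩
  · rw [← (commute_diagTorus_neg_one b⁻¹).eq, mul_inv_cancel_right, ← map_inv, inv_neg, inv_one]
  · rw [← map_zpow, ← map_zpow, ← map_mul, hpow, ← mul_zpow, neg_mul_neg, one_mul, one_zpow,
      map_one]
  · rw [inv_pow, hb, mul_inv_cancel]
end
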